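/- Let Γ be a countable discrete group, Σ = {F_n} a sequence of nonempty finite subsets, and suppose b ∈ Γ fixes Σ from the right (lim |bF_n Δ F_n|/|F_n| = 0). If Λ ⊆ Γ has positive upper density with respect to Σ, then for every positive integer k there exist n > 0 and a ∈ Γ such that b^{jn} a ∈ Λ for all j = 0, 1, ..., k−1. -/

import Mathlib

open Filter Topology

namespace DensityHalesJewett

open Combinatorics
open scoped BigOperators

/-! ### Densities -/

/-- The uniform density of a set in a finite type. -/
noncomputable def dens {X : Type*} [Fintype X] (A : Set X) : ℝ :=
  𝔼 x, A.indicator (fun _ => (1 : ℝ)) x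

section Averages

variable {X Y : Type*} [Fintype X] [Fintype Y]

lemma expect_mono {f g : X → ℝ} (h : ∀ x, f x ≤ g x) : 𝔼 x, f x ≤ 𝔼 x, g x :=
  Finset.expect_le_expect fun x _ => h x

lemma dens_nonneg (A : Set X) : 0 ≤ dens A :=
  Finset.expect_nonneg fun x _ => Set.indicator_nonneg (fun _ _ => zero_le_one) x

lemma dens_le_one (A : Set X) : dens A ≤ 1 := by
  rcases isEmpty_or_nonempty X with h | h
  · simp [dens]
  · calc dens A ≤ 𝔼 _x : X, (1 : ℝ) :=
          expect_mono fun x => Set.indicator_le_self' (fun _ _ => zero_le_one) x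
      _ = 1 := Fintype.expect_const _

lemma dens_mono {A B : Set X} (h : A ⊆ B) : dens A ≤ dens B :=
  expect_mono fun x => Set.indicator_le_indicator_of_subset h (fun _ => zero_le_one) x

lemma dens_compl [Nonempty X] (A : Set X) : dens Aᶜ = 1 - dens A := by
  have h : ∀ x, (Aᶜ).indicator (fun _ => (1 : ℝ)) x = 1 - A.indicator (fun _ => (1 : ℝ)) x := by
    intro x
    by_cases hx : x ∈ A <;> simp [hx]
  simp only [dens, h, Finset.expect_sub_distrib, Fintype.expect_const]

lemma nonempty_of_dens_pos {A : Set X} (h : 0 < dens A) : A.Nonempty := by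
  by_contra hA
  rw [Set.not_nonempty_iff_eq_empty] at hA
  simp [dens, hA] at h

/-- The average of the densities of the sections of a relation does not depend on the side. -/
lemma expect_dens_comm (R : X → Y → Prop) :
    𝔼 x, dens {y | R x y} = 𝔼 y, dens {x | R x y} := by
  simp only [dens]
  rw [Finset.expect_comm]
  rfl

lemma exists_le_of_le_expect [Nonempty X] {f : X → ℝ} {c : ℝ} (h : c ≤ 𝔼 x, f x) :
    ∃ x, c ≤ f x := by
  by_contra! hlt
  rw [Fintype.expect_eq_sum_div_card, le_div_iff₀ (by simp [Fintype.card_pos])] at h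
  have : ∑ x, f x < ∑ _x : X, c :=
    Finset.sum_lt_sum_of_nonempty Finset.univ_nonempty fun x _ => hlt x
  rw [Finset.sum_const, Finset.card_univ, nsmul_eq_mul] at this
  linarith

lemma exists_le_dens_of_forall_le [Nonempty X] [Nonempty Y] (R : X → Y → Prop) {c : ℝ}
    (h : ∀ y, c ≤ dens {x | R x y}) : ∃ x, c ≤ dens {y | R x y} := by
  refine exists_le_of_le_expect ?_
  rw [expect_dens_comm]
  calc c = 𝔼 _y : Y, c := (Fintype.expect_const _).symm
    _ ≤ _ := expect_mono h

/-- A set of parameters that is large on average is large for many parameters. -/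
lemma half_le_dens_of_le_expect {f : X → ℝ} {c : ℝ} (hf : ∀ x, f x ≤ 1) (hc : 0 < c)
    (h : c ≤ 𝔼 x, f x) : c / 2 ≤ dens {x | c / 2 ≤ f x} := by
  have h1 : 𝔼 x, f x ≤ 𝔼 x, (({x | c / 2 ≤ f x} : Set X).indicator (fun _ => (1 : ℝ)) x + c / 2) :=
    expect_mono fun x => by
      by_cases hx : c / 2 ≤ f x
      · rw [Set.indicator_of_mem (by exact hx)]
        linarith [hf x]
      · rw [Set.indicator_of_notMem (by exact hx)]
        linarith
  rw [Finset.expect_add_distrib] at h1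
  have h2 : 𝔼 _x : X, c / 2 ≤ c / 2 := by
    rcases isEmpty_or_nonempty X with hX | hX
    · simp only [Finset.univ_eq_empty, Finset.expect_empty]
      linarith
    · rw [Fintype.expect_const]
  simp only [dens]
  linarith

/-- The pigeonhole principle for densities. -/
lemma exists_dens_ge {S : Type*} [Fintype S] (P : S → X → Prop) {c : ℝ} (hc : 0 < c)
    (h : c ≤ dens {x | ∃ s, P s x}) : ∃ s, c / (Fintype.card S + 1) ≤ dens {x | P s x} := by
  by_contra! hcon
  have h1 : dens {x | ∃ s, P s x} ≤ ∑ s, dens {x | P s x} := by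
    simp only [dens]
    rw [← Finset.expect_sum_comm]
    refine expect_mono fun x => ?_
    by_cases hx : ∃ s, P s x
    · rw [Set.indicator_of_mem (by exact hx)]
      obtain ⟨s, hs⟩ := hx
      calc (1 : ℝ) = ({x | P s x} : Set X).indicator (fun _ => (1 : ℝ)) x := by
            rw [Set.indicator_of_mem (by exact hs)]
        _ ≤ _ := Finset.single_le_sum
            (f := fun s => ({x | P s x} : Set X).indicator (fun _ => (1 : ℝ)) x)
            (fun s _ => Set.indicator_nonneg (fun _ _ => zero_le_one) x) (Finset.mem_univ s)
    · rw [Set.indicator_of_notMem (by exact hx)]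
      exact Finset.sum_nonneg fun s _ => Set.indicator_nonneg (fun _ _ => zero_le_one) x
  have h2 : ∑ s, dens {x | P s x} ≤ ∑ _s : S, c / (Fintype.card S + 1) :=
    Finset.sum_le_sum fun s _ => (hcon s).le
  rw [Finset.sum_const, Finset.card_univ, nsmul_eq_mul] at h2
  have h3 : Fintype.card S * (c / (Fintype.card S + 1)) < c := by
    rw [← mul_div_assoc, div_lt_iff₀ (by positivity)]
    linarith
  linarith

/-- If all sufficiently dense sections of a relation have a pattern, then some pattern
is popular. -/
lemma exists_popular {S : Type*} [Fintype S] (R : X → Y → Prop) (P : S → Y → Prop) {c : ℝ}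
    (hc : 0 < c) (h : c ≤ 𝔼 y, dens {x | R x y})
    (hP : ∀ y, c / 2 ≤ dens {x | R x y} → ∃ s, P s y) :
    ∃ s, c / 2 / (Fintype.card S + 1) ≤ dens {y | P s y} :=
  exists_dens_ge P (by linarith)
    ((half_le_dens_of_le_expect (fun _ => dens_le_one _) hc h).trans (dens_mono hP))

end Averages

/-! ### Concatenation of words -/

section Append

variable {α : Type*} [Fintype α] {n₁ n₂ : ℕ}

lemma expect_append (f : (Fin (n₁ + n₂) → α) → ℝ) :
    𝔼 z, f z = 𝔼 x, 𝔼 y, f (Fin.append x y) := by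
  rw [← Finset.expect_product']
  exact (Fintype.expect_equiv (Fin.appendEquiv n₁ n₂) _ _ fun p => rfl).symm

lemma dens_append (A : Set (Fin (n₁ + n₂) → α)) :
    dens A = 𝔼 x, dens {y | Fin.append x y ∈ A} :=
  expect_append _

lemma dens_append' (A : Set (Fin (n₁ + n₂) → α)) :
    dens A = 𝔼 y, dens {x | Fin.append x y ∈ A} := by
  rw [dens_append, expect_dens_comm]

end Append

/-! ### Operations on combinatorial lines and subspaces -/

section Subspaces

variable {α : Type*} {m n n₁ n₂ : ℕ}

instance {η ι : Type*} [Finite η] [Finite α] [Finite ι] : Finite (Subspace η α ι) :=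
  Finite.of_injective (fun φ => φ.idxFun) fun _ _ h => Subspace.ext h

instance {ι : Type*} [Finite α] [Finite ι] : Finite (Line α ι) :=
  Finite.of_injective (fun φ => φ.idxFun) fun l l' h => by cases l; cases l'; simp_all

/-- Composition of combinatorial subspaces. -/
def comp {η ζ ι : Type*} (φ : Subspace η α ι) (ψ : Subspace ζ α η) : Subspace ζ α ι where
  idxFun i := Sum.elim Sum.inl ψ.idxFun (φ.idxFun i)
  proper e := by
    obtain ⟨j, hj⟩ := ψ.proper e
    obtain ⟨i, hi⟩ := φ.proper j
    exact ⟨i, by simp [hi, hj]⟩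

lemma comp_apply {η ζ ι : Type*} (φ : Subspace η α ι) (ψ : Subspace ζ α η) (x : ζ → α) :
    comp φ ψ x = φ (ψ x) := by
  ext i
  simp only [comp, Subspace.apply_def]
  cases φ.idxFun i <;> simp [Subspace.apply_def]

lemma subspace_injective {η ι : Type*} (φ : Subspace η α ι) : Function.Injective φ := by
  intro x y hxy
  ext e
  obtain ⟨i, hi⟩ := φ.proper e
  simpa [Subspace.apply_def, hi] using congrFun hxy i

/-- Extend a subspace by a constant word on the right. -/
def appendConst (φ : Subspace (Fin m) α (Fin n₁)) (t : Fin n₂ → α) :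
    Subspace (Fin m) α (Fin (n₁ + n₂)) where
  idxFun := Fin.append φ.idxFun fun i => Sum.inl (t i)
  proper e := by
    obtain ⟨i, hi⟩ := φ.proper e
    exact ⟨Fin.castAdd n₂ i, by simp [hi]⟩

lemma appendConst_apply (φ : Subspace (Fin m) α (Fin n₁)) (t : Fin n₂ → α) (x : Fin m → α) :
    appendConst φ t x = Fin.append (φ x) t := by
  ext i
  induction i using Fin.addCases <;> simp [appendConst, Subspace.apply_def]

/-- Extend a subspace by a constant word on the left. -/
def constAppend (t : Fin n₁ → α) (φ : Subspace (Fin m) α (Fin n₂)) :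
    Subspace (Fin m) α (Fin (n₁ + n₂)) where
  idxFun := Fin.append (fun i => Sum.inl (t i)) φ.idxFun
  proper e := by
    obtain ⟨i, hi⟩ := φ.proper e
    exact ⟨Fin.natAdd n₁ i, by simp [hi]⟩

lemma constAppend_apply (t : Fin n₁ → α) (φ : Subspace (Fin m) α (Fin n₂)) (x : Fin m → α) :
    constAppend t φ x = Fin.append t (φ x) := by
  ext i
  induction i using Fin.addCases <;> simp [constAppend, Subspace.apply_def]

/-- Append a line to a subspace; the line carries the new last variable. -/
def appendLine (φ : Subspace (Fin m) α (Fin n₁)) (l : Line α (Fin n₂)) :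
    Subspace (Fin (m + 1)) α (Fin (n₁ + n₂)) where
  idxFun := Fin.append (fun i => Sum.map id Fin.castSucc (φ.idxFun i))
    fun i => (l.idxFun i).elim (Sum.inr (Fin.last m)) Sum.inl
  proper e := by
    induction e using Fin.lastCases with
    | last =>
      obtain ⟨i, hi⟩ := l.proper
      exact ⟨Fin.natAdd n₁ i, by simp [hi]⟩
    | cast e =>
      obtain ⟨i, hi⟩ := φ.proper e
      exact ⟨Fin.castAdd n₂ i, by simp [hi]⟩

lemma appendLine_apply (φ : Subspace (Fin m) α (Fin n₁)) (l : Line α (Fin n₂))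
    (x : Fin (m + 1) → α) :
    appendLine φ l x = Fin.append (φ (fun i => x i.castSucc)) (l (x (Fin.last m))) := by
  ext i
  induction i using Fin.addCases with
  | left i =>
    simp only [appendLine, Subspace.apply_def, Fin.append_left]
    cases φ.idxFun i <;> simp
  | right i =>
    simp only [appendLine, Subspace.apply_def, Fin.append_right, Line.apply_def]
    cases l.idxFun i <;> simp

/-- The image of a line under a subspace. -/
def mapLine {η ι : Type*} (φ : Subspace η α ι) (l : Line α η) : Line α ι where
  idxFun i := Sum.elim some l.idxFun (φ.idxFun i)
  proper := by
    obtain ⟨j, hj⟩ := l.proper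
    obtain ⟨i, hi⟩ := φ.proper j
    exact ⟨i, by simp [hi, hj]⟩

lemma mapLine_apply {η ι : Type*} (φ : Subspace η α ι) (l : Line α η) (a : α) :
    mapLine φ l a = φ (l a) := by
  ext i
  simp only [mapLine, Subspace.apply_def, Line.apply_def]
  cases φ.idxFun i <;> simp

/-- Extend a line by a constant word on the left. -/
def constAppendLine (t : Fin n₁ → α) (l : Line α (Fin n₂)) : Line α (Fin (n₁ + n₂)) where
  idxFun := Fin.append (fun i => some (t i)) l.idxFun
  proper := by
    obtain ⟨i, hi⟩ := l.proper
    exact ⟨Fin.natAdd n₁ i, by simp [hi]⟩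

lemma constAppendLine_apply (t : Fin n₁ → α) (l : Line α (Fin n₂)) (a : α) :
    constAppendLine t l a = Fin.append t (l a) := by
  ext i
  induction i using Fin.addCases <;> simp [constAppendLine, Line.apply_def]

/-- Extend a line by a constant word on the right. -/
def appendConstLine (l : Line α (Fin n₁)) (t : Fin n₂ → α) : Line α (Fin (n₁ + n₂)) where
  idxFun := Fin.append l.idxFun fun i => some (t i)
  proper := by
    obtain ⟨i, hi⟩ := l.proper
    exact ⟨Fin.castAdd n₂ i, by simp [hi]⟩

lemma appendConstLine_apply (l : Line α (Fin n₁)) (t : Fin n₂ → α) (a : α) :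
    appendConstLine l t a = Fin.append (l a) t := by
  ext i
  induction i using Fin.addCases <;> simp [appendConstLine, Line.apply_def]

end Subspaces

/-! ### The density Hales–Jewett property and its multidimensional version -/

/-- The density Hales–Jewett property at density `δ`: dense sets of long words over the alphabet
`α` contain a combinatorial line. -/
def LineProperty (α : Type*) [Fintype α] (δ : ℝ) : Prop :=
  ∃ n₀, ∀ n ≥ n₀, ∀ A : Set (Fin n → α), δ ≤ dens A → ∃ l : Line α (Fin n), ∀ a, l a ∈ A

/-- The density Hales–Jewett property for `m`-dimensional subspaces. -/
def SubspaceProperty (α : Type*) [Fintype α] (m : ℕ) (δ : ℝ) : Prop :=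
  ∃ n₀, ∀ n ≥ n₀, ∀ A : Set (Fin n → α), δ ≤ dens A →
    ∃ φ : Subspace (Fin m) α (Fin n), ∀ x, φ x ∈ A

lemma LineProperty.subspaceProperty {α : Type*} [Fintype α]
    (h : ∀ δ > 0, LineProperty α δ) (m : ℕ) : ∀ δ > 0, SubspaceProperty α m δ := by
  induction m with
  | zero =>
    refine fun δ hδ => ⟨0, fun n _ A hA => ?_⟩
    obtain ⟨x, hx⟩ := nonempty_of_dens_pos (hδ.trans_le hA)
    exact ⟨⟨fun i => Sum.inl (x i), fun e => e.elim0⟩, fun _ => hx⟩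
  | succ m ih =>
    intro δ hδ
    obtain ⟨n₁, hn₁⟩ := ih (δ / 2) (by linarith)
    have := Fintype.ofFinite (Subspace (Fin m) α (Fin n₁))
    obtain ⟨n₂, hn₂⟩ := h (δ / 2 / (Fintype.card (Subspace (Fin m) α (Fin n₁)) + 1)) (by positivity)
    refine ⟨n₁ + n₂, fun n hn A hA => ?_⟩
    obtain ⟨k, rfl⟩ := Nat.exists_eq_add_of_le (le_trans (Nat.le_add_right n₁ n₂) hn)
    rw [dens_append'] at hA
    obtain ⟨φ, hφ⟩ := exists_popular (fun x y => Fin.append x y ∈ A)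
      (fun (φ : Subspace (Fin m) α (Fin n₁)) y => ∀ x, Fin.append (φ x) y ∈ A) hδ hA
      fun y hy => hn₁ n₁ le_rfl _ hy
    obtain ⟨l, hl⟩ := hn₂ k (by omega) _ hφ
    exact ⟨appendLine φ l, fun x => appendLine_apply φ l x ▸ hl _ _⟩

/-! ### Insensitive sets -/

section Insensitive

variable {α : Type*} {n m : ℕ}

/-- A set of words over `Option α` is insensitive with respect to `a` if membership is not affected
by exchanging the letters `none` and `some a`. -/
def Insensitive {ι : Type*} (a : α) (E : Set (ι → Option α)) : Prop :=
  ∀ x y, (∀ i, (x i).getD a = (y i).getD a) → x ∈ E → y ∈ E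

lemma Insensitive.compl {ι : Type*} {a : α} {E : Set (ι → Option α)} (h : Insensitive a E) :
    Insensitive a Eᶜ :=
  fun x y hxy hx hy => hx (h y x (fun i => (hxy i).symm) hy)

lemma Insensitive.preimage_subspace {η ι : Type*} {a : α} {E : Set (ι → Option α)}
    (h : Insensitive a E) (φ : Subspace η (Option α) ι) : Insensitive a {x | φ x ∈ E} := by
  refine fun x y hxy hx => h _ _ (fun i => ?_) hx
  simp only [Subspace.apply_def]
  cases φ.idxFun i <;> simp [hxy]

/-- The set of coordinates where a word over `Option α` is not equal to `none`. -/
def someSupport (x : Fin n → Option α) : Finset (Fin n) :=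
  Finset.univ.filter fun i => (x i).isSome = true

lemma mem_someSupport (x : Fin n → Option α) (i : Fin n) :
    i ∈ someSupport x ↔ (x i).isSome = true := by
  simp [someSupport]

lemma dens_card_someSupport_lt [Fintype α] [Nonempty α] (n₀ : ℕ) :
    dens {x : Fin n → Option α | (someSupport x).card < n₀} ≤ 2 ^ n₀ * (3 / 4 : ℝ) ^ n := by
  have hk : (1 : ℝ) ≤ Fintype.card α := by exact_mod_cast Fintype.card_pos
  let g : Option α → ℝ := fun b => if b.isSome = true then 1 / 2 else 1
  have h1 : ∀ x : Fin n → Option α,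
      ({x : Fin n → Option α | (someSupport x).card < n₀} : Set _).indicator
        (fun _ => (1 : ℝ)) x ≤ 2 ^ n₀ * ∏ i, g (x i) := by
    intro x
    have hprod : ∏ i, g (x i) = (1 / 2) ^ (someSupport x).card := by
      simp only [g, someSupport]
      rw [Finset.prod_ite]
      simp
    rw [hprod]
    refine Set.indicator_apply_le' (fun hx => ?_) (fun _ => by positivity)
    have hx' : (someSupport x).card ≤ n₀ := le_of_lt hx
    rw [one_div, inv_pow, ← div_eq_mul_inv, one_le_div (by positivity)]
    exact pow_le_pow_right₀ one_le_two hx'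
  refine (expect_mono h1).trans ?_
  rw [← Finset.mul_expect, Fintype.expect_eq_sum_div_card, ← Fintype.sum_pow]
  refine mul_le_mul_of_nonneg_left ?_ (by positivity)
  rw [Fintype.card_fun, Fintype.card_fin, Fintype.card_option]
  push_cast
  rw [← div_pow]
  refine pow_le_pow_left₀ (div_nonneg (Finset.sum_nonneg fun b _ => ?_) (by positivity)) ?_ n
  · simp only [g]
    split_ifs <;> norm_num
  · rw [Fintype.sum_option, div_le_iff₀ (by positivity)]
    simp only [g, Option.isSome_some, Option.isSome_none, if_true, Finset.sum_const,
      Finset.card_univ, nsmul_eq_mul]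
    norm_num
    linarith

/-- The word over `Option α` with given support and given non-`none` letters. -/
noncomputable def extendNone (S : Finset (Fin n)) (y : Fin S.card → α) : Fin n → Option α :=
  fun i => if h : i ∈ S then some (y (S.equivFin ⟨i, h⟩)) else none

lemma expect_extendNone [Fintype α] (S : Finset (Fin n)) (f : (Fin n → Option α) → ℝ) :
    𝔼 y, f (extendNone S y) = 𝔼 x with someSupport x = S, f x := by
  refine Finset.expect_bij (fun y _ => extendNone S y) ?_ (fun _ _ => rfl) ?_ ?_
  · intro y _
    simp only [Finset.mem_filter, Finset.mem_univ, true_and]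
    ext i
    by_cases h : i ∈ S <;> simp [mem_someSupport, extendNone, h]
  · intro y _ y' _ h
    ext j
    have := congrFun h (S.equivFin.symm j)
    simpa [extendNone] using this
  · intro x hx
    simp only [Finset.mem_filter, Finset.mem_univ, true_and] at hx
    have hs : ∀ j, (x (S.equivFin.symm j)).isSome = true := fun j => by
      rw [← mem_someSupport, hx]
      exact (S.equivFin.symm j).2
    refine ⟨fun j => (x (S.equivFin.symm j)).get (hs j), Finset.mem_univ _, ?_⟩
    ext1 i
    by_cases h : i ∈ S
    · simp [extendNone, h]
    · have hi : ¬ (x i).isSome = true := by rwa [← mem_someSupport, hx]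
      rw [Option.not_isSome_iff_eq_none] at hi
      simp [extendNone, h, hi]

/-- A dense set of long words is dense among the words with some fixed large support. -/
lemma exists_support_dens_ge [Fintype α] [Nonempty α] (n₀ : ℕ) {δ : ℝ} (hδ : 0 < δ)
    (hn : 2 ^ n₀ * (3 / 4 : ℝ) ^ n < δ / 2) (E : Set (Fin n → Option α)) (hE : δ ≤ dens E) :
    ∃ S : Finset (Fin n), n₀ ≤ S.card ∧ δ / 2 ≤ dens {y | extendNone S y ∈ E} := by
  by_contra! hcon
  let small : Set (Fin n → Option α) := {x | (someSupport x).card < n₀}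
  let f : (Fin n → Option α) → ℝ := fun x =>
    E.indicator (fun _ => (1 : ℝ)) x - small.indicator (fun _ => (1 : ℝ)) x
  have h1 : ∀ S : Finset (Fin n), ∑ x with someSupport x = S, f x ≤
      ∑ x : Fin n → Option α with someSupport x = S, δ / 2 := by
    intro S
    by_cases hS : n₀ ≤ S.card
    · have h2 := hcon S hS
      have h3 : dens {y | extendNone S y ∈ E} =
          𝔼 x with someSupport x = S, E.indicator (fun _ => (1 : ℝ)) x :=
        expect_extendNone S (E.indicator fun _ => (1 : ℝ))
      rw [h3] at h2
      calc ∑ x with someSupport x = S, f x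
          ≤ ∑ x with someSupport x = S, E.indicator (fun _ => (1 : ℝ)) x :=
            Finset.sum_le_sum fun x _ => sub_le_self _
              (Set.indicator_nonneg (fun _ _ => zero_le_one) x)
        _ ≤ _ := by
            rw [← Finset.card_mul_expect, Finset.sum_const, nsmul_eq_mul]
            exact mul_le_mul_of_nonneg_left h2.le (Nat.cast_nonneg _)
    · refine Finset.sum_le_sum fun x hx => ?_
      simp only [Finset.mem_filter, Finset.mem_univ, true_and] at hx
      have hx' : x ∈ small := by
        change (someSupport x).card < n₀
        rw [hx]
        omega
      have h4 : E.indicator (fun _ => (1 : ℝ)) x ≤ 1 :=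
        Set.indicator_le_self' (fun _ _ => zero_le_one) x
      simp only [f]
      rw [Set.indicator_of_mem hx']
      linarith
  have h5 : ∑ x, f x ≤ ∑ _x : Fin n → Option α, δ / 2 := by
    rw [← Finset.sum_fiberwise (s := Finset.univ) (g := someSupport) (f := f),
      ← Finset.sum_fiberwise (s := Finset.univ) (g := someSupport) (f := fun _ => δ / 2)]
    exact Finset.sum_le_sum fun S _ => h1 S
  have h6 : 𝔼 x, f x ≤ δ / 2 := by
    rw [Fintype.expect_eq_sum_div_card, div_le_iff₀ (by exact_mod_cast Fintype.card_pos)]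
    simpa [mul_comm] using h5
  have h7 : 𝔼 x, f x = dens E - dens small := Finset.expect_sub_distrib _ _ _
  have h8 := dens_card_someSupport_lt (α := α) (n := n) n₀
  have h9 : dens small ≤ 2 ^ n₀ * (3 / 4 : ℝ) ^ n := h8
  linarith

/-- Subspaces over `α` give subspaces over `Option α` inside insensitive sets. -/
lemma Insensitive.exists_subspace {a : α} {E : Set (Fin n → Option α)} (hE : Insensitive a E)
    (S : Finset (Fin n)) (ψ : Subspace (Fin m) α (Fin S.card))
    (hψ : ∀ x, extendNone S (ψ x) ∈ E) :
    ∃ φ : Subspace (Fin m) (Option α) (Fin n), ∀ x, φ x ∈ E := by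
  refine ⟨⟨fun i => if h : i ∈ S then Sum.map some id (ψ.idxFun (S.equivFin ⟨i, h⟩))
    else Sum.inl none, fun e => ?_⟩, fun x => ?_⟩
  · obtain ⟨j, hj⟩ := ψ.proper e
    exact ⟨S.equivFin.symm j, by simp [hj]⟩
  · refine hE _ _ (fun i => ?_) (hψ fun j => (x j).getD a)
    by_cases h : i ∈ S
    · simp only [extendNone, Subspace.apply_def, h, dif_pos]
      cases ψ.idxFun (S.equivFin ⟨i, h⟩) <;> simp
    · simp [extendNone, Subspace.apply_def, h]

/-- Dense insensitive sets of long words contain subspaces. -/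
lemma exists_subspace_of_insensitive [Fintype α] [Nonempty α] {δ : ℝ} (hδ : 0 < δ)
    (h : SubspaceProperty α m (δ / 2)) :
    ∃ n₀, ∀ n ≥ n₀, ∀ (a : α) (E : Set (Fin n → Option α)), Insensitive a E → δ ≤ dens E →
      ∃ φ : Subspace (Fin m) (Option α) (Fin n), ∀ x, φ x ∈ E := by
  obtain ⟨n₁, hn₁⟩ := h
  have hlim : Tendsto (fun n : ℕ => 2 ^ n₁ * (3 / 4 : ℝ) ^ n) atTop (𝓝 (2 ^ n₁ * 0)) :=
    (tendsto_pow_atTop_nhds_zero_of_lt_one (by norm_num) (by norm_num)).const_mul _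
  rw [mul_zero] at hlim
  obtain ⟨n₀, hn₀⟩ := eventually_atTop.1 (hlim.eventually_lt_const (half_pos hδ))
  refine ⟨n₀, fun n hn a E hins hE => ?_⟩
  obtain ⟨S, hS, hSE⟩ := exists_support_dens_ge n₁ hδ (hn₀ n hn) E hE
  obtain ⟨ψ, hψ⟩ := hn₁ S.card hS _ hSE
  exact hins.exists_subspace S ψ hψ

end Insensitive

/-! ### Functions with nonpositive averages on subspaces -/

section Nonpos

variable {β : Type*} [Fintype β] {n m : ℕ}

/-- The average of `f` over every `m`-dimensional combinatorial subspace is nonpositive. -/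
def NonposOnSubspaces (m : ℕ) (f : (Fin n → β) → ℝ) : Prop :=
  ∀ φ : Subspace (Fin m) β (Fin n), 𝔼 x, f (φ x) ≤ 0

lemma NonposOnSubspaces.comp_subspace {k : ℕ} {f : (Fin n → β) → ℝ} (hf : NonposOnSubspaces m f)
    (φ : Subspace (Fin k) β (Fin n)) : NonposOnSubspaces m fun x => f (φ x) := by
  intro ψ
  simpa only [comp_apply] using hf (comp φ ψ)

lemma NonposOnSubspaces.append_left {n₁ n₂ : ℕ} {f : (Fin (n₁ + n₂) → β) → ℝ}
    (hf : NonposOnSubspaces m f) (x : Fin n₁ → β) :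
    NonposOnSubspaces m fun y => f (Fin.append x y) := by
  intro φ
  simpa only [constAppend_apply] using hf (constAppend x φ)

lemma expect_indicator_le_dens {X : Type*} [Fintype X] {f : X → ℝ} (hf : ∀ x, f x ≤ 1)
    (E : Set X) : 𝔼 x, E.indicator f x ≤ dens E :=
  expect_mono fun x => Set.indicator_le_indicator (hf x)

/-- The contribution of a product of a subspace and another set is nonpositive. -/
lemma NonposOnSubspaces.expect_indicator_prod_nonpos {n₁ n₂ : ℕ} {f : (Fin (n₁ + n₂) → β) → ℝ}
    (hf : NonposOnSubspaces m f) (φ : Subspace (Fin m) β (Fin n₁)) (T : Set (Fin n₂ → β)) :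
    𝔼 x, 𝔼 t, (Set.range φ).indicator (fun x => T.indicator (fun t => f (Fin.append x t)) t) x
      ≤ 0 := by
  rw [Finset.expect_comm]
  refine (expect_mono (g := fun _ => 0) fun t => ?_).trans_eq (Finset.expect_const_zero _)
  by_cases ht : t ∈ T
  · simp only [Set.indicator_of_mem ht]
    rw [Fintype.expect_eq_sum_div_card]
    refine div_nonpos_of_nonpos_of_nonneg ?_ (Nat.cast_nonneg _)
    have h1 : ∑ x, (Set.range φ).indicator (fun x => f (Fin.append x t)) x =
        ∑ y, f (Fin.append (φ y) t) := by
      classical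
      rw [← Finset.sum_subset (Finset.subset_univ (Finset.univ.image φ)) fun x _ hx =>
        Set.indicator_of_notMem (by simpa using hx) _,
        Finset.sum_image fun x _ y _ h => subspace_injective φ h]
      simp
    have h2 := hf (appendConst φ t)
    simp only [appendConst_apply] at h2
    rw [h1, ← Fintype.card_mul_expect]
    exact mul_nonpos_of_nonneg_of_nonpos (Nat.cast_nonneg _) h2
  · simp [Set.indicator_of_notMem ht]

lemma le_dens_range_subspace [Nonempty β] {n₁ : ℕ} (φ : Subspace (Fin m) β (Fin n₁)) :
    1 / (Fintype.card (Fin n₁ → β) : ℝ) ≤ dens (Set.range φ) := by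
  rw [dens, Fintype.expect_eq_sum_div_card]
  refine div_le_div_of_nonneg_right ?_ (Nat.cast_nonneg _)
  have x : Fin m → β := Classical.arbitrary _
  calc (1 : ℝ) = (Set.range φ).indicator (fun _ => (1 : ℝ)) (φ x) := by simp
    _ ≤ _ := Finset.single_le_sum
      (f := fun z => (Set.range φ).indicator (fun _ => (1 : ℝ)) z)
      (fun z _ => Set.indicator_nonneg (fun _ _ => zero_le_one) z) (Finset.mem_univ _)

end Nonpos

section Partition

variable {α : Type*} [Fintype α] [Nonempty α] {m : ℕ}

/-- Greedy removal of subspaces from an insensitive set. -/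
lemma expect_indicator_insensitive_le_aux {ε θ : ℝ} {n₁ : ℕ} (hθ : θ ≤ 1)
    (hstep : ∀ n₂ (a : α) (E : Set (Fin (n₁ + n₂) → Option α)), Insensitive a E → ε ≤ dens E →
      ∃ φ : Subspace (Fin m) (Option α) (Fin n₁),
        θ ≤ dens (Set.range φ) * dens {t | ∀ x, Fin.append (φ x) t ∈ E}) (hε : 0 ≤ ε) (r : ℕ) :
    ∀ n ≥ r * n₁, ∀ f : (Fin n → Option α) → ℝ, (∀ x, f x ≤ 1) → NonposOnSubspaces m f →
      ∀ (a : α) (E : Set (Fin n → Option α)), Insensitive a E →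
        𝔼 x, E.indicator f x ≤ ε + (1 - θ) ^ r * dens E := by
  induction r with
  | zero =>
    intro n _ f hf _ a E _
    have := expect_indicator_le_dens hf E
    simp only [pow_zero, one_mul]
    linarith
  | succ r ih =>
    intro n hn f hf hnp a E hE
    have hpow : 0 ≤ (1 - θ) ^ r := pow_nonneg (by linarith) r
    rcases lt_or_ge (dens E) ε with hlt | hge
    · have h1 := expect_indicator_le_dens hf E
      have h2 : 0 ≤ (1 - θ) ^ (r + 1) * dens E :=
        mul_nonneg (pow_nonneg (by linarith) _) (dens_nonneg E)
      linarith
    obtain ⟨n₂, rfl⟩ := Nat.exists_eq_add_of_le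
      (show n₁ ≤ n from le_trans (by rw [Nat.succ_mul]; omega) hn)
    rw [Nat.succ_mul] at hn
    obtain ⟨φ, hφ⟩ := hstep n₂ a E hE hge
    set T : Set (Fin n₂ → Option α) := {t | ∀ x, Fin.append (φ x) t ∈ E} with hT
    let E' : (Fin n₁ → Option α) → Set (Fin n₂ → Option α) := fun x =>
      {t | Fin.append x t ∈ E ∧ ¬ (x ∈ Set.range φ ∧ t ∈ T)}
    have hE' : ∀ x, Insensitive a (E' x) := by
      intro x s t hst hs
      have happ : ∀ x : Fin n₁ → Option α,
          ∀ i, ((Fin.append x s : Fin (n₁ + n₂) → Option α) i).getD a =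
            ((Fin.append x t : Fin (n₁ + n₂) → Option α) i).getD a := by
        intro x i
        induction i using Fin.addCases <;> simp [hst]
      refine ⟨hE _ _ (happ x) hs.1, fun h => hs.2 ⟨h.1, fun y => ?_⟩⟩
      exact hE _ _ (fun i => (happ (φ y) i).symm) (h.2 y)
    have hsplit : ∀ (g : (Fin (n₁ + n₂) → Option α) → ℝ) x t, E.indicator g (Fin.append x t) =
        (Set.range φ).indicator (fun x => T.indicator (fun t => g (Fin.append x t)) t) x +
          (E' x).indicator (fun t => g (Fin.append x t)) t := by
      intro g x t
      by_cases hx : x ∈ Set.range φ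
      · by_cases ht : t ∈ T
        · have h1 : Fin.append x t ∈ E := by
            obtain ⟨y, rfl⟩ := hx
            exact ht y
          have h2 : t ∉ E' x := fun h => h.2 ⟨hx, ht⟩
          rw [Set.indicator_of_mem h1, Set.indicator_of_mem hx, Set.indicator_of_mem ht,
            Set.indicator_of_notMem h2, add_zero]
        · rw [Set.indicator_of_mem hx, Set.indicator_of_notMem ht, zero_add]
          by_cases h1 : Fin.append x t ∈ E
          · have h2 : t ∈ E' x := ⟨h1, fun h => ht h.2⟩
            rw [Set.indicator_of_mem h1, Set.indicator_of_mem h2]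
          · have h2 : t ∉ E' x := fun h => h1 h.1
            rw [Set.indicator_of_notMem h1, Set.indicator_of_notMem h2]
      · rw [Set.indicator_of_notMem hx, zero_add]
        by_cases h1 : Fin.append x t ∈ E
        · have h2 : t ∈ E' x := ⟨h1, fun h => hx h.1⟩
          rw [Set.indicator_of_mem h1, Set.indicator_of_mem h2]
        · have h2 : t ∉ E' x := fun h => h1 h.1
          rw [Set.indicator_of_notMem h1, Set.indicator_of_notMem h2]
    have hdens : dens E = dens (Set.range φ) * dens T + 𝔼 x, dens (E' x) := by
      have h1 : dens E = 𝔼 x, 𝔼 t, E.indicator (fun _ => (1 : ℝ)) (Fin.append x t) :=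
        expect_append _
      simp only [hsplit, Finset.expect_add_distrib] at h1
      rw [h1]
      congr 1
      rw [dens, dens, Finset.expect_mul_expect]
      refine Finset.expect_congr rfl fun x _ => Finset.expect_congr rfl fun t _ => ?_
      by_cases hx : x ∈ Set.range φ
      · rw [Set.indicator_of_mem hx, Set.indicator_of_mem hx, one_mul]
      · rw [Set.indicator_of_notMem hx, Set.indicator_of_notMem hx, zero_mul]
    have hbound : 𝔼 x, dens (E' x) ≤ (1 - θ) * dens E := by
      have h1 := dens_le_one E
      have h2 := dens_nonneg E
      rcases le_or_gt 0 θ with h0 | h0 <;> nlinarith [Finset.expect_nonneg (s := Finset.univ)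
        (f := fun x => dens (E' x)) fun x _ => dens_nonneg (E' x),
        mul_nonneg (dens_nonneg (Set.range φ)) (dens_nonneg T)]
    calc 𝔼 z, E.indicator f z
        = 𝔼 x, 𝔼 t, E.indicator f (Fin.append x t) := expect_append _
      _ ≤ 𝔼 x, 𝔼 t, (E' x).indicator (fun t => f (Fin.append x t)) t := by
          simp only [hsplit, Finset.expect_add_distrib]
          linarith [hnp.expect_indicator_prod_nonpos φ T]
      _ ≤ 𝔼 x, (ε + (1 - θ) ^ r * dens (E' x)) := expect_mono fun x =>
          ih n₂ (by omega) _ (fun t => hf _) (hnp.append_left x) a _ (hE' x)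
      _ = ε + (1 - θ) ^ r * 𝔼 x, dens (E' x) := by
          rw [Finset.expect_add_distrib, Fintype.expect_const, Finset.mul_expect]
      _ ≤ ε + (1 - θ) ^ (r + 1) * dens E := by
          rw [pow_succ, mul_assoc]
          gcongr

/-- A function bounded by `1` with nonpositive averages on subspaces has almost nonpositive
average on insensitive sets. -/
lemma expect_indicator_insensitive_le (h : ∀ δ > 0, SubspaceProperty α m δ) {ε : ℝ} (hε : 0 < ε) :
    ∃ n₀, ∀ n ≥ n₀, ∀ f : (Fin n → Option α) → ℝ, (∀ x, f x ≤ 1) → NonposOnSubspaces m f →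
      ∀ (a : α) (E : Set (Fin n → Option α)), Insensitive a E → 𝔼 x, E.indicator f x ≤ ε := by
  obtain ⟨n₁, hn₁⟩ := exists_subspace_of_insensitive (m := m) (δ := ε / 2 / 2) (by positivity)
    (h _ (by positivity))
  have := Fintype.ofFinite (Subspace (Fin m) (Option α) (Fin n₁))
  set θ : ℝ := 1 / (Fintype.card (Fin n₁ → Option α) : ℝ) *
    (ε / 2 / 2 / (Fintype.card (Subspace (Fin m) (Option α) (Fin n₁)) + 1)) with hθ
  have hcard : 0 < (Fintype.card (Fin n₁ → Option α) : ℝ) := by exact_mod_cast Fintype.card_pos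
  have hθ0 : 0 < θ := by positivity
  have hstep : ∀ n₂ (a : α) (E : Set (Fin (n₁ + n₂) → Option α)), Insensitive a E →
      ε / 2 ≤ dens E → ∃ φ : Subspace (Fin m) (Option α) (Fin n₁),
        θ ≤ dens (Set.range φ) * dens {t | ∀ x, Fin.append (φ x) t ∈ E} := by
    intro n₂ a E hE hd
    rw [dens_append'] at hd
    obtain ⟨φ, hφ⟩ := exists_popular (fun x y => Fin.append x y ∈ E)
      (fun (φ : Subspace (Fin m) (Option α) (Fin n₁)) y => ∀ x, Fin.append (φ x) y ∈ E)
      (by positivity) hd fun y hy => hn₁ n₁ le_rfl a _ (fun s t hst hs => by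
        refine hE _ _ (fun i => ?_) hs
        induction i using Fin.addCases <;> simp [hst]) hy
    exact ⟨φ, mul_le_mul (le_dens_range_subspace φ) hφ (by positivity) (dens_nonneg _)⟩
  by_cases hθ1 : θ ≤ 1
  · obtain ⟨r, hr⟩ := exists_pow_lt_of_lt_one (half_pos hε) (show 1 - θ < 1 by linarith)
    refine ⟨r * n₁, fun n hn f hf hnp a E hE => ?_⟩
    have h1 := expect_indicator_insensitive_le_aux hθ1 hstep (by positivity) r n hn f hf hnp a E hE
    have h2 : (1 - θ) ^ r * dens E ≤ (1 - θ) ^ r * 1 :=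
      mul_le_mul_of_nonneg_left (dens_le_one E) (pow_nonneg (by linarith) r)
    linarith
  · refine ⟨n₁, fun n hn f hf hnp a E hE => ?_⟩
    by_contra! hcon
    obtain ⟨n₂, rfl⟩ := Nat.exists_eq_add_of_le hn
    have h1 := expect_indicator_le_dens hf E
    obtain ⟨φ, hφ⟩ := hstep n₂ a E hE (by linarith)
    refine hθ1 (hφ.trans (mul_le_one₀ (dens_le_one _) (dens_nonneg _) (dens_le_one _)))

/-- A function bounded by `1` with nonpositive averages on subspaces has almost nonpositive
average on the complement of an intersection of insensitive sets. -/
lemma expect_indicator_compl_iInter_le (h : ∀ m, ∀ δ > 0, SubspaceProperty α m δ) (m : ℕ)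
    (s : Finset α) : ∀ ε > (0 : ℝ),
    ∃ n₀, ∀ n ≥ n₀, ∀ f : (Fin n → Option α) → ℝ, (∀ x, f x ≤ 1) → NonposOnSubspaces m f →
      ∀ E : α → Set (Fin n → Option α), (∀ a, Insensitive a (E a)) →
        𝔼 x, ({x | ∀ a ∈ s, x ∈ E a} : Set _)ᶜ.indicator f x ≤ ε := by
  classical
  induction s using Finset.induction_on with
  | empty =>
    intro ε hε
    refine ⟨0, fun n _ f _ _ E _ => ?_⟩
    simpa using hε.le
  | insert a s _ ih =>
    intro ε hε
    obtain ⟨m₁, hm₁⟩ := ih (ε / 3) (by positivity)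
    obtain ⟨n₁, hn₁⟩ := expect_indicator_insensitive_le (h m) (ε := ε / 3) (by positivity)
    obtain ⟨n₂, hn₂⟩ := expect_indicator_insensitive_le (h m₁) (ε := ε / 3) (by positivity)
    refine ⟨max n₁ n₂, fun n hn f hf hnp E hE => ?_⟩
    set D : Set (Fin n → Option α) := {x | ∀ a ∈ s, x ∈ E a} with hD
    have h1 := hn₁ n (le_of_max_le_left hn) f hf hnp a _ (hE a).compl
    have h2 := hn₂ n (le_of_max_le_right hn) (fun x => Dᶜ.indicator f x - ε / 3) (fun x => by
      have : Dᶜ.indicator f x ≤ 1 := Set.indicator_apply_le' (fun _ => hf x) fun _ => zero_le_one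
      linarith) (fun φ => by
        rw [Finset.expect_sub_distrib, Fintype.expect_const, sub_nonpos]
        exact hm₁ m₁ le_rfl (fun x => f (φ x)) (fun x => hf _) (hnp.comp_subspace φ)
          (fun b => {x | φ x ∈ E b}) fun b => (hE b).preimage_subspace φ) a _ (hE a)
    have h3 : ∀ x, ({x | ∀ b ∈ insert a s, x ∈ E b} : Set _)ᶜ.indicator f x ≤
        (E a)ᶜ.indicator f x + (E a).indicator (fun x => Dᶜ.indicator f x - ε / 3) x + ε / 3 := by
      intro x
      by_cases hx : x ∈ E a
      · have : x ∈ ({x | ∀ b ∈ insert a s, x ∈ E b} : Set _)ᶜ ↔ x ∈ Dᶜ := by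
          simp [hD, hx]
        rw [Set.indicator_of_notMem (show x ∉ (E a)ᶜ from fun h => h hx),
          Set.indicator_of_mem hx]
        by_cases hx' : x ∈ Dᶜ
        · rw [Set.indicator_of_mem hx', Set.indicator_of_mem (this.2 hx')]
          linarith
        · rw [Set.indicator_of_notMem hx', Set.indicator_of_notMem (mt this.1 hx')]
          linarith
      · rw [Set.indicator_of_mem (show x ∈ (E a)ᶜ from hx), Set.indicator_of_notMem hx,
          Set.indicator_of_mem (show x ∈ ({x | ∀ b ∈ insert a s, x ∈ E b} : Set _)ᶜ from
            fun h => hx (h a (Finset.mem_insert_self a s)))]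
        linarith
    refine (expect_mono h3).trans ?_
    rw [Finset.expect_add_distrib, Finset.expect_add_distrib, Fintype.expect_const]
    linarith

end Partition

/-! ### A Graham–Rothschild theorem for combinatorial lines -/

section GrahamRothschild

variable {α : Type} {m n : ℕ}

/-- The action of a subspace on words with wildcards. -/
def mapWord {η ι : Type*} (φ : Subspace η α ι) (w : η → Option α) : ι → Option α :=
  fun i => Sum.elim some w (φ.idxFun i)

lemma mapWord_comp {η ζ ι : Type*} (φ : Subspace η α ι) (ψ : Subspace ζ α η) (w : ζ → Option α) :
    mapWord (comp φ ψ) w = mapWord φ (mapWord ψ w) := by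
  ext1 i
  simp only [comp, mapWord]
  cases φ.idxFun i <;> simp [mapWord]

/-- The color of a word with wildcards only depends on its initial segment up to any wildcard. -/
def PrefixDependent {K : Type*} (c : (Fin n → Option α) → K) : Prop :=
  ∀ j w w', w j = none → (∀ i ≤ j, w i = w' i) → c w = c w'

lemma exists_subspace_prefixDependent [Finite α] (m : ℕ) : ∀ (K : Type) [Finite K],
    ∃ n, ∀ c : (Fin n → Option α) → K, ∃ φ : Subspace (Fin m) α (Fin n),
      PrefixDependent fun w => c (mapWord φ w) := by
  induction m with
  | zero =>
    refine fun K _ => ⟨0, fun c => ⟨⟨Fin.elim0, fun e => e.elim0⟩, fun j => j.elim0⟩⟩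
  | succ m ih =>
    intro K _
    obtain ⟨M, hM⟩ := ih (α → K)
    obtain ⟨N, hN⟩ := Subspace.exists_mono_in_high_dimension_fin (Option α) K (Fin M)
    refine ⟨N + 1, fun c => ?_⟩
    obtain ⟨l, g, hl⟩ := hN fun y => c (Fin.cons none y)
    let F : Option α → (Fin M → Option α) → Fin (N + 1) → Option α := fun b w =>
      Fin.cons b fun i => Sum.elim (fun a => a.elim b some) w (l.idxFun i)
    obtain ⟨φ, hφ⟩ := hM fun w a => c (F (some a) w)
    let φ' : Subspace (Fin (m + 1)) α (Fin (N + 1)) :=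
      { idxFun := Fin.cons (Sum.inr 0) fun i => Sum.elim (fun a => a.elim (Sum.inr 0) Sum.inl)
          (fun j => Sum.map id Fin.succ (φ.idxFun j)) (l.idxFun i)
        proper := fun e => by
          induction e using Fin.cases with
          | zero => exact ⟨0, rfl⟩
          | succ e =>
            obtain ⟨j, hj⟩ := φ.proper e
            obtain ⟨i, hi⟩ := l.proper j
            exact ⟨i.succ, by simp [hi, hj]⟩ }
    have hφ' : ∀ w, mapWord φ' w = F (w 0) (mapWord φ (Fin.tail w)) := by
      intro w
      ext1 i
      induction i using Fin.cases with
      | zero => simp [mapWord, φ', F]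
      | succ i =>
        simp only [mapWord, φ', F, Fin.cons_succ]
        rcases l.idxFun i with (_ | a) | j
        · simp
        · simp
        · simp only [Sum.elim_inr, mapWord]
          cases φ.idxFun j <;> simp [Fin.tail]
    refine ⟨φ', fun j w w' hj hw => ?_⟩
    simp only [hφ']
    rw [← hw 0 (Fin.zero_le j)]
    rcases h0 : w 0 with _ | a
    · have hF : ∀ v, F none v = Fin.cons none (l v) := by
        intro v
        simp only [F]
        congr 1
        ext1 i
        simp only [Subspace.apply_def]
        rcases l.idxFun i with (_ | a) | j <;> simp
      rw [hF, hF]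
      exact (hl _).trans (hl _).symm
    · induction j using Fin.cases with
      | zero => simp [h0] at hj
      | succ j =>
        exact congrFun (hφ j (Fin.tail w) (Fin.tail w') hj
          fun i hi => hw i.succ (Fin.succ_le_succ_iff.2 hi)) a

lemma exists_subspace_firstDependent [Finite α] [Nonempty α] (K : Type) [Finite K] (m : ℕ) :
    ∃ n, ∀ c : (Fin n → Option α) → K, PrefixDependent c →
      ∃ (φ : Subspace (Fin m) α (Fin n)) (g : Fin m → K), ∀ w j, w j = none →
        (∀ i < j, w i ≠ none) → c (mapWord φ w) = g j := by
  induction m with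
  | zero =>
    exact ⟨0, fun c _ => ⟨⟨Fin.elim0, fun e => e.elim0⟩, Fin.elim0, fun _ j => j.elim0⟩⟩
  | succ m ih =>
    obtain ⟨n₂, hn₂⟩ := ih
    obtain ⟨n₁, hn₁⟩ :=
      Subspace.exists_mono_in_high_dimension_fin α ((Fin n₂ → Option α) → K) (Fin 1)
    refine ⟨n₁ + n₂, fun c hc => ?_⟩
    obtain ⟨l, G, hl⟩ := hn₁ fun x y => c (Fin.append (fun i => some (x i)) y)
    have hl' : ∀ x y, c (Fin.append (fun i => some (l x i)) y) = G y :=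
      fun x y => congrFun (hl x) y
    have hG : PrefixDependent G := by
      intro j w w' hj hw
      have x : Fin 1 → α := Classical.arbitrary _
      rw [← hl' x, ← hl' x]
      refine hc (Fin.natAdd n₁ j) _ _ (by simpa using hj) fun i hi => ?_
      induction i using Fin.addCases with
      | left i => simp
      | right i =>
        rw [Fin.append_right, Fin.append_right]
        refine hw i ?_
        simp only [Fin.le_def, Fin.val_natAdd] at hi ⊢
        omega
    obtain ⟨φ, g, hφ⟩ := hn₂ G hG
    let φ' : Subspace (Fin (m + 1)) α (Fin (n₁ + n₂)) :=
      { idxFun := Fin.append (fun i => Sum.map id (fun _ => 0) (l.idxFun i))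
          fun i => Sum.map id Fin.succ (φ.idxFun i)
        proper := fun e => by
          induction e using Fin.cases with
          | zero =>
            obtain ⟨i, hi⟩ := l.proper 0
            exact ⟨Fin.castAdd n₂ i, by simp [hi]⟩
          | succ e =>
            obtain ⟨i, hi⟩ := φ.proper e
            exact ⟨Fin.natAdd n₁ i, by simp [hi]⟩ }
    have hφ' : ∀ w, mapWord φ' w =
        Fin.append (mapWord l fun _ => w 0) (mapWord φ (Fin.tail w)) := by
      intro w
      ext1 i
      induction i using Fin.addCases with
      | left i =>
        simp only [mapWord, φ', Fin.append_left]
        cases l.idxFun i <;> simp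
      | right i =>
        simp only [mapWord, φ', Fin.append_right]
        cases φ.idxFun i <;> simp [Fin.tail]
    refine ⟨φ', Fin.cons (c (Fin.append (mapWord l fun _ => none) fun _ => none)) g,
      fun w j hj hw => ?_⟩
    rw [hφ']
    induction j using Fin.cases with
    | zero =>
      rw [hj, Fin.cons_zero]
      obtain ⟨i₀, hi₀⟩ := l.proper 0
      refine hc (Fin.castAdd n₂ i₀) _ _ (by simp [mapWord, hi₀]) fun i hi => ?_
      induction i using Fin.addCases with
      | left i => simp
      | right i =>
        simp only [Fin.le_def, Fin.val_natAdd, Fin.val_castAdd] at hi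
        omega
    | succ j =>
      obtain ⟨a, ha⟩ := Option.ne_none_iff_exists'.1 (hw 0 (Fin.succ_pos j))
      have hsome : (mapWord l fun _ => w 0) = fun i => some (l (fun _ => a) i) := by
        ext1 i
        simp only [mapWord, Subspace.apply_def, ha]
        cases l.idxFun i <;> simp
      rw [hsome, hl', Fin.cons_succ]
      exact hφ (Fin.tail w) j hj fun i hi => hw i.succ (Fin.succ_lt_succ_iff.2 hi)

/-- For any finite coloring of the lines in a high-dimensional space, there is a subspace all of
whose lines have the same color. -/
lemma exists_subspace_mono_lines [Finite α] [Nonempty α] (K : Type) [Finite K] [Nonempty K] (m : ℕ) :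
    ∃ n, ∀ c : Line α (Fin n) → K, ∃ (φ : Subspace (Fin m) α (Fin n)) (g : K),
      ∀ l, c (mapLine φ l) = g := by
  classical
  have := Fintype.ofFinite K
  obtain ⟨n₂, hn₂⟩ := exists_subspace_firstDependent (α := α) K (Fintype.card K * m)
  obtain ⟨n₁, hn₁⟩ := exists_subspace_prefixDependent (α := α) n₂ K
  refine ⟨n₁, fun c => ?_⟩
  let c' : (Fin n₁ → Option α) → K := fun w => if h : ∃ i, w i = none then c ⟨w, h⟩
    else Classical.arbitrary K
  obtain ⟨φ, hφ⟩ := hn₁ c'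
  obtain ⟨ψ, g, hψ⟩ := hn₂ _ hφ
  obtain ⟨k, hk⟩ := Fintype.exists_le_card_fiber_of_mul_le_card g
    (n := m) (by simp)
  let e := Finset.orderEmbOfCardLe _ hk
  have he : ∀ j, g (e j) = k := fun j => by
    have := Finset.orderEmbOfCardLe_mem _ hk j
    simpa using this
  have a₀ : α := Classical.arbitrary α
  let χ : Subspace (Fin m) α (Fin (Fintype.card K * m)) :=
    { idxFun := fun i => if h : ∃ j, e j = i then Sum.inr h.choose else Sum.inl a₀
      proper := fun j => by
        have h : ∃ j', e j' = e j := ⟨j, rfl⟩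
        exact ⟨e j, by rw [dif_pos h, e.injective h.choose_spec]⟩ }
  have hχ : ∀ w j, mapWord χ w (e j) = w j := by
    intro w j
    have h : ∃ j', e j' = e j := ⟨j, rfl⟩
    simp only [mapWord, χ, dif_pos h, Sum.elim_inr]
    rw [e.injective h.choose_spec]
  refine ⟨comp φ (comp ψ χ), k, fun l => ?_⟩
  have hc : c (mapLine (comp φ (comp ψ χ)) l) = c' (mapWord φ (mapWord ψ (mapWord χ l.idxFun))) := by
    rw [← mapWord_comp ψ χ, ← mapWord_comp φ (comp ψ χ)]
    have hp : ∃ i, mapWord (comp φ (comp ψ χ)) l.idxFun i = none :=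
      (mapLine (comp φ (comp ψ χ)) l).proper
    simp only [c', dif_pos hp]
    rfl
  rw [hc]
  have hex : (Finset.univ.filter fun j => l.idxFun j = none).Nonempty := by
    obtain ⟨j, hj⟩ := l.proper
    exact ⟨j, by simp [hj]⟩
  set j := (Finset.univ.filter fun j => l.idxFun j = none).min' hex with hj
  have hjmem : l.idxFun j = none := by
    simpa using Finset.min'_mem _ hex
  rw [hψ (mapWord χ l.idxFun) (e j) (by rw [hχ, hjmem]) fun i hi => ?_, he]
  by_cases h : ∃ j', e j' = i
  · obtain ⟨j', rfl⟩ := h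
    rw [hχ]
    intro hnone
    have h1 : j ≤ j' := Finset.min'_le _ _ (by simp [hnone])
    exact absurd (e.lt_iff_lt.1 hi) (not_lt.2 h1)
  · simp [mapWord, χ, h]

end GrahamRothschild

/-! ### The density increment -/

section Increment

variable {α : Type} {m n N : ℕ}

/-- A subspace over `α` viewed as a subspace over `Option α`. -/
def liftSubspace {η ι : Type*} (φ : Subspace η α ι) : Subspace η (Option α) ι where
  idxFun i := Sum.map some id (φ.idxFun i)
  proper e := by
    obtain ⟨i, hi⟩ := φ.proper e
    exact ⟨i, by simp [hi]⟩

lemma liftSubspace_some {η ι : Type*} (φ : Subspace η α ι) (x : η → α) :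
    (liftSubspace φ (fun j => some (x j)) : ι → Option α) = fun i => some (φ x i) := by
  ext1 i
  simp only [liftSubspace, Subspace.apply_def]
  cases φ.idxFun i <;> simp

lemma dens_forall_ne_none [Fintype α] :
    dens {x : Fin n → Option α | ∀ i, x i ≠ none} =
      ((Fintype.card α : ℝ) / (Fintype.card α + 1)) ^ n := by
  let g : Option α → ℝ := fun b => b.elim 0 fun _ => 1
  have h1 : ∀ x : Fin n → Option α,
      ({x : Fin n → Option α | ∀ i, x i ≠ none} : Set _).indicator (fun _ => (1 : ℝ)) x =
        ∏ i, g (x i) := by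
    intro x
    by_cases hx : ∀ i, x i ≠ none
    · rw [Set.indicator_of_mem (by exact hx), Finset.prod_eq_one]
      intro i _
      obtain ⟨a, ha⟩ := Option.ne_none_iff_exists'.1 (hx i)
      simp [g, ha]
    · rw [Set.indicator_of_notMem (by exact hx)]
      push Not at hx
      obtain ⟨i, hi⟩ := hx
      exact (Finset.prod_eq_zero (Finset.mem_univ i) (by simp [g, hi])).symm
  simp only [dens, h1]
  rw [Fintype.expect_eq_sum_div_card, ← Fintype.sum_pow, Fintype.card_fun, Fintype.card_fin,
    Fintype.card_option, Fintype.sum_option]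
  push_cast
  rw [← div_pow]
  simp [g]

/-- The words `x` for which all the words obtained by replacing `none` with a letter of `α` belong
to a given set. -/
def lineBase {ι : Type*} (A : Set (ι → Option α)) : Set (ι → Option α) :=
  {x | ∀ a, (fun i => some ((x i).getD a)) ∈ A}

lemma dens_le_of_lineFree [Fintype α] {δ γ : ℝ} (hδ : 0 ≤ δ)
    (hline : ∀ B : Set (Fin m → Option α), δ ≤ dens B →
      ∃ l : Line (Option α) (Fin m), ∀ a, l a ∈ B)
    (hsub : ∀ f : (Fin n → Option α) → ℝ, (∀ x, f x ≤ 1) → NonposOnSubspaces m f →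
      ∀ E : α → Set (Fin n → Option α), (∀ a, Insensitive a (E a)) →
        𝔼 x, ({x | ∀ a ∈ (Finset.univ : Finset α), x ∈ E a} : Set _)ᶜ.indicator f x ≤ γ)
    {A : Set (Fin n → Option α)} (hA : ∀ l : Line (Option α) (Fin n), ∃ a, l a ∉ A) :
    dens A ≤ dens {x : Fin n → Option α | ∀ i, x i ≠ none} + γ + δ * (1 - dens (lineBase A)) := by
  have h1 := hsub (fun x => A.indicator (fun _ => (1 : ℝ)) x - δ) (fun x => by
      have : A.indicator (fun _ => (1 : ℝ)) x ≤ 1 :=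
        Set.indicator_le_self' (fun _ _ => zero_le_one) x
      linarith) (fun ψ => by
      rw [Finset.expect_sub_distrib, Fintype.expect_const]
      by_contra! hcon
      obtain ⟨l, hl⟩ := hline (ψ ⁻¹' A) (by
        simp only [dens]
        exact (sub_pos.1 hcon).le)
      obtain ⟨a, ha⟩ := hA (mapLine ψ l)
      exact ha (mapLine_apply ψ l a ▸ hl a))
    (fun a => {x | (fun i => some ((x i).getD a)) ∈ A}) (fun a x y hxy hx => by
      simpa only [Set.mem_ofPred_eq, hxy] using hx)
  have h2 : ({x | ∀ a ∈ (Finset.univ : Finset α),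
      x ∈ ({x | (fun i => some ((x i).getD a)) ∈ A} : Set (Fin n → Option α))} : Set _) =
      lineBase A := by
    ext x
    simp [lineBase]
  rw [h2] at h1
  rw [← dens_compl]
  have h3 : ∀ x, A.indicator (fun _ => (1 : ℝ)) x ≤
      ({x : Fin n → Option α | ∀ i, x i ≠ none} : Set _).indicator (fun _ => (1 : ℝ)) x +
        (lineBase A)ᶜ.indicator (fun x => A.indicator (fun _ => (1 : ℝ)) x - δ) x +
        δ * (lineBase A)ᶜ.indicator (fun _ => (1 : ℝ)) x := by
    intro x
    have h4 : 0 ≤ ({x : Fin n → Option α | ∀ i, x i ≠ none} : Set _).indicator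
      (fun _ => (1 : ℝ)) x := Set.indicator_nonneg (fun _ _ => zero_le_one) x
    by_cases hx : x ∈ lineBase A
    · rw [Set.indicator_of_notMem (s := (lineBase A)ᶜ) (by simpa using hx),
        Set.indicator_of_notMem (s := (lineBase A)ᶜ) (by simpa using hx)]
      by_cases hxA : x ∈ A
      · have hnone : ∀ i, x i ≠ none := by
          by_contra! hnone
          obtain ⟨i, hi⟩ := hnone
          obtain ⟨b, hb⟩ := hA ⟨fun i => (x i).map some, i, by simp [hi]⟩
          refine hb ?_
          cases b with
          | none =>
            convert hxA using 1
            ext1 i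
            simp only [Line.apply_def]
            cases x i <;> rfl
          | some a =>
            convert hx a using 1
            ext1 i
            simp only [Line.apply_def]
            cases x i <;> rfl
        rw [Set.indicator_of_mem hxA, Set.indicator_of_mem (by exact hnone)]
        simp
      · rw [Set.indicator_of_notMem hxA]
        linarith
    · rw [Set.indicator_of_mem (s := (lineBase A)ᶜ) (by simpa using hx),
        Set.indicator_of_mem (s := (lineBase A)ᶜ) (by simpa using hx)]
      linarith
  refine (expect_mono h3).trans ?_
  rw [Finset.expect_add_distrib, Finset.expect_add_distrib, ← Finset.mul_expect]
  simp only [dens]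
  linarith

/-- If all sections of a set have density at most slightly more than the average, then none of
them has density much smaller. -/
lemma le_dens_of_le_expect {X : Type*} [Fintype X] {f : X → ℝ} {c η : ℝ} (hη : 0 ≤ η)
    (h : c - η ≤ 𝔼 x, f x) (hf : ∀ x, f x ≤ c + η) (x : X) :
    c - 2 * Fintype.card X * η ≤ f x := by
  classical
  have : Nonempty X := ⟨x⟩
  rw [Fintype.expect_eq_sum_div_card, le_div_iff₀ (by simp [Fintype.card_pos]),
    ← Finset.add_sum_erase _ _ (Finset.mem_univ x)] at h
  have h1 := Finset.sum_le_card_nsmul (Finset.univ.erase x) f (c + η) fun y _ => hf y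
  rw [Finset.card_erase_of_mem (Finset.mem_univ x), Finset.card_univ, nsmul_eq_mul,
    Nat.cast_sub Fintype.card_pos] at h1
  push_cast at h1
  linarith

lemma exists_dens_line_ge [Fintype α] [Nonempty α] {Y : Type*} [Fintype Y] {n₀ : ℕ} {c : ℝ}
    (hc : 0 < c) [Fintype (Line α (Fin n₀))]
    (hn₀ : ∀ A : Set (Fin n₀ → α), c / 2 ≤ dens A → ∃ l : Line α (Fin n₀), ∀ a, l a ∈ A)
    (hn : n₀ ≤ n) (R : (Fin n → α) → Y → Prop) (hR : ∀ x, c ≤ dens {y | R x y}) :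
    ∃ l : Line α (Fin n),
      c / 2 / (Fintype.card (Line α (Fin n₀)) + 1) ≤ dens {y | ∀ a, R (l a) y} := by
  have a₀ : α := Classical.arbitrary α
  let ψ : Subspace (Fin n₀) α (Fin n) :=
    { idxFun := fun i => if h : i.1 < n₀ then Sum.inr ⟨i, h⟩ else Sum.inl a₀
      proper := fun e => ⟨Fin.castLE hn e, by simp⟩ }
  obtain ⟨l, hl⟩ := exists_popular (fun x y => R (ψ x) y)
    (fun (l : Line α (Fin n₀)) y => ∀ a, R (ψ (l a)) y) hc (by
      rw [← expect_dens_comm]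
      calc c = 𝔼 _x : Fin n₀ → α, c := (Fintype.expect_const c).symm
        _ ≤ _ := expect_mono fun x => hR (ψ x)) fun y hy => hn₀ _ hy
  exact ⟨mapLine ψ l, by simpa only [mapLine_apply] using hl⟩

/-- If the density Hales–Jewett property holds over `α`, and over `Option α` at all densities
larger than `D`, then it also holds over `Option α` at a density smaller than `D`. -/
lemma LineProperty.exists_lt [Fintype α] [Nonempty α] (h : ∀ δ > 0, LineProperty α δ) {D : ℝ}
    (hD : 0 < D) (hup : ∀ γ > 0, LineProperty (Option α) (D + γ)) :
    ∃ η > 0, LineProperty (Option α) (D - η) := by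
  classical
  obtain ⟨n₀, hn₀⟩ := h (D / 2 / 2) (by positivity)
  have := Fintype.ofFinite (Line α (Fin n₀))
  obtain ⟨θ, hθ⟩ : ∃ θ, θ = D / 2 / 2 / (Fintype.card (Line α (Fin n₀)) + 1) := ⟨_, rfl⟩
  have hθ0 : 0 < θ := by
    rw [hθ]
    positivity
  obtain ⟨γ, hγ0, hγθ, hγD, hγ1⟩ : ∃ γ > 0, γ ≤ D * θ / 16 ∧ γ ≤ D / 2 ∧ γ ≤ 1 / 2 :=
    ⟨min (D * θ / 16) (min (D / 2) (1 / 2)), by positivity, min_le_left _ _,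
      (min_le_right _ _).trans (min_le_left _ _), (min_le_right _ _).trans (min_le_right _ _)⟩
  obtain ⟨m, hm⟩ := hup γ hγ0
  obtain ⟨n₃, hn₃⟩ := expect_indicator_compl_iInter_le
    (fun m => LineProperty.subspaceProperty h m) m Finset.univ γ hγ0
  obtain ⟨n₄, hn₄⟩ := exists_pow_lt_of_lt_one hγ0
    (show (Fintype.card α : ℝ) / (Fintype.card α + 1) < 1 by
      rw [div_lt_one (by positivity)]
      linarith)
  obtain ⟨M, hM0, hM3, hM4⟩ : ∃ M, n₀ ≤ M ∧ n₃ ≤ M ∧ n₄ ≤ M :=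
    ⟨max n₀ (max n₃ n₄), by simp, by simp, by simp⟩
  have hnone : dens {x : Fin M → Option α | ∀ i, x i ≠ none} ≤ γ := by
    rw [dens_forall_ne_none]
    refine (pow_le_pow_of_le_one (by positivity) ?_ hM4).trans hn₄.le
    rw [div_le_one (by positivity)]
    linarith
  obtain ⟨N, hN⟩ := exists_subspace_mono_lines (α := α) Prop M
  obtain ⟨Q, hQ⟩ : ∃ Q : ℕ, Q = Fintype.card (Fin N → Option α) := ⟨_, rfl⟩
  have hQ0 : (0 : ℝ) < Q := by
    rw [hQ]
    exact_mod_cast Fintype.card_pos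
  obtain ⟨η, hη⟩ : ∃ η, η = γ / (2 * Q) := ⟨_, rfl⟩
  have hη0 : 0 < η := by
    rw [hη]
    positivity
  have hηγ : 2 * Q * η = γ := by
    rw [hη]
    field_simp
  obtain ⟨n', hn'⟩ := hup η hη0
  refine ⟨η, hη0, N + n', fun n hn A hA => ?_⟩
  obtain ⟨n₂, rfl⟩ := Nat.exists_eq_add_of_le ((Nat.le_add_right N n').trans hn)
  by_contra! hfree
  have hslice : ∀ x : Fin N → Option α, D - γ ≤ dens {t | Fin.append x t ∈ A} := by
    rw [dens_append] at hA
    rw [← hηγ, hQ]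
    refine le_dens_of_le_expect hη0.le hA fun x => ?_
    by_contra! hcon
    obtain ⟨l, hl⟩ := hn' n₂ (by omega) _ hcon.le
    obtain ⟨a, ha⟩ := hfree (constAppendLine x l)
    exact ha (constAppendLine_apply x l a ▸ hl a)
  obtain ⟨φ, g, hφ⟩ := hN fun l =>
    θ ≤ dens {t | ∀ a, Fin.append (fun i => some (l a i)) t ∈ A}
  have hgood : ∀ l : Line α (Fin M),
      θ ≤ dens {t | ∀ a, Fin.append (fun i => some (φ (l a) i)) t ∈ A} := by
    obtain ⟨l₀, hl₀⟩ := exists_dens_line_ge (half_pos hD) (hn₀ n₀ le_rfl) hM0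
      (fun x t => Fin.append (fun i => some (φ x i)) t ∈ A)
      fun x => (show D / 2 ≤ D - γ by linarith).trans (hslice _)
    intro l
    have h1 := (hφ l).trans (hφ l₀).symm
    simp only [mapLine_apply] at h1
    rw [h1, hθ]
    exact hl₀
  let A' : (Fin n₂ → Option α) → Set (Fin M → Option α) :=
    fun t => {x | Fin.append (liftSubspace φ x) t ∈ A}
  have hA' : ∀ t, dens (A' t) ≤ γ + γ + (D + γ) * (1 - dens (lineBase (A' t))) := by
    intro t
    have h1 := dens_le_of_lineFree (by linarith) (hm m le_rfl) (hn₃ M hM3) (A := A' t)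
      fun l => by
        obtain ⟨a, ha⟩ := hfree (appendConstLine (mapLine (liftSubspace φ) l) t)
        exact ⟨a, fun hmem => ha (by rw [appendConstLine_apply, mapLine_apply]; exact hmem)⟩
    linarith
  have hlow : D - γ ≤ 𝔼 t, dens (A' t) := by
    calc D - γ = 𝔼 _x : Fin M → Option α, (D - γ) := (Fintype.expect_const _).symm
      _ ≤ 𝔼 x : Fin M → Option α, dens {t | Fin.append (liftSubspace φ x) t ∈ A} :=
        expect_mono fun x => hslice _
      _ = _ := expect_dens_comm _
  have hbase : θ * (1 - γ) ≤ 𝔼 t, dens (lineBase (A' t)) := by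
    calc θ * (1 - γ) ≤ θ * dens {x : Fin M → Option α | ∀ i, x i ≠ none}ᶜ := by
          rw [dens_compl]
          gcongr
      _ ≤ 𝔼 x : Fin M → Option α, dens {t | x ∈ lineBase (A' t)} := by
          rw [dens, Finset.mul_expect]
          refine expect_mono fun x => ?_
          by_cases hx : ∀ i, x i ≠ none
          · rw [Set.indicator_of_notMem (by simpa using hx), mul_zero]
            exact dens_nonneg _
          · rw [Set.indicator_of_mem (by exact hx), mul_one]
            push Not at hx
            refine (hgood ⟨x, hx⟩).trans (dens_mono fun t ht a => ?_)
            simpa only [A', Set.mem_ofPred_eq, liftSubspace_some, Line.apply_def] using ht a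
      _ = _ := expect_dens_comm _
  have hsum := expect_mono hA'
  rw [Finset.expect_add_distrib, ← Finset.mul_expect, Finset.expect_sub_distrib,
    Fintype.expect_const, Fintype.expect_const] at hsum
  have h1 : θ / 2 ≤ 𝔼 t, dens (lineBase (A' t)) := by nlinarith
  have h2 : D * (θ / 2) ≤ (D + γ) * 𝔼 t, dens (lineBase (A' t)) := by gcongr; linarith
  nlinarith [mul_pos hD hθ0]

lemma LineProperty.mono {δ δ' : ℝ} [Fintype α] (h : LineProperty α δ) (hδ : δ ≤ δ') :
    LineProperty α δ' := by
  obtain ⟨n₀, hn₀⟩ := h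
  exact ⟨n₀, fun n hn A hA => hn₀ n hn A (hδ.trans hA)⟩

lemma LineProperty.option [Fintype α] [Nonempty α] (h : ∀ δ > 0, LineProperty α δ) :
    ∀ δ > 0, LineProperty (Option α) δ := by
  intro δ hδ
  by_contra hcon
  let S : Set ℝ := {δ | LineProperty (Option α) δ}
  have hlb : ∀ x ∈ S, δ ≤ x := fun x hx => by
    by_contra! hlt
    exact hcon (LineProperty.mono hx hlt.le)
  have hne : S.Nonempty := ⟨2, 0, fun n _ A hA => by linarith [dens_le_one A]⟩
  obtain ⟨η, hη, hgood⟩ := LineProperty.exists_lt h (hδ.trans_le (le_csInf hne hlb))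
    fun γ hγ => by
      obtain ⟨x, hx, hlt⟩ := exists_lt_of_csInf_lt hne (lt_add_of_pos_right (sInf S) hγ)
      exact LineProperty.mono hx hlt.le
  linarith [csInf_le ⟨δ, hlb⟩ hgood]

end Increment

/-! ### The density Hales–Jewett theorem -/

lemma LineProperty.of_equiv {α β : Type} [Fintype α] [Fintype β] (e : α ≃ β) {δ : ℝ}
    (h : LineProperty α δ) : LineProperty β δ := by
  obtain ⟨n₀, hn₀⟩ := h
  refine ⟨n₀, fun n hn A hA => ?_⟩
  obtain ⟨l, hl⟩ := hn₀ n hn {x | (fun i => e (x i)) ∈ A} (by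
    refine hA.trans (le_of_eq ?_)
    exact (Fintype.expect_equiv (Equiv.piCongrRight fun _ => e) _ _ fun x => rfl).symm)
  refine ⟨l.map e, fun b => ?_⟩
  have h := Line.map_apply e l (e.symm b)
  rw [e.apply_symm_apply] at h
  rw [h]
  exact hl (e.symm b)

lemma LineProperty.of_subsingleton {α : Type} [Fintype α] [Subsingleton α] {δ : ℝ} (hδ : 0 < δ) :
    LineProperty α δ := by
  refine ⟨1, fun n hn A hA => ?_⟩
  obtain ⟨x, hx⟩ := nonempty_of_dens_pos (hδ.trans_le hA)
  have : Nonempty (Fin n) := ⟨⟨0, hn⟩⟩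
  refine ⟨Line.diagonal α (Fin n), fun a => ?_⟩
  convert hx

/-- The density Hales–Jewett theorem. -/
theorem lineProperty_fin (k : ℕ) : ∀ δ > 0, LineProperty (Fin k) δ := by
  induction k with
  | zero => exact fun δ hδ => LineProperty.of_subsingleton hδ
  | succ k ih =>
    rcases k.eq_zero_or_pos with rfl | hk
    · have : Subsingleton (Fin (0 + 1)) := inferInstanceAs (Subsingleton (Fin 1))
      exact fun δ hδ => LineProperty.of_subsingleton hδ
    · have : Nonempty (Fin k) := ⟨⟨0, hk⟩⟩
      exact fun δ hδ => LineProperty.of_equiv (finSuccEquiv k).symm (LineProperty.option ih δ hδ)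

/-! ### Translates along an almost invariant finite set -/

lemma card_filter_pow_mul_ge {Γ : Type*} [Group Γ] [DecidableEq Γ] (F : Finset Γ) (b : Γ)
    (Λ : Set Γ) [DecidablePred (· ∈ Λ)] (s : ℕ) :
    (F.filter (· ∈ Λ)).card ≤ (F.filter fun a => b ^ s * a ∈ Λ).card +
      s * (symmDiff (F.image fun x => b * x) F).card := by
  induction s with
  | zero => simp
  | succ s ih =>
    have h1 : F.filter (fun a => b ^ s * a ∈ Λ) ⊆
        (F.filter fun a => b ^ (s + 1) * a ∈ Λ).image (fun x => b * x) ∪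
          symmDiff (F.image fun x => b * x) F := by
      intro y hy
      rw [Finset.mem_filter] at hy
      rw [Finset.mem_union]
      by_cases hyb : y ∈ F.image fun x => b * x
      · left
        obtain ⟨x, hx, rfl⟩ := Finset.mem_image.1 hyb
        refine Finset.mem_image_of_mem _ (Finset.mem_filter.2 ⟨hx, ?_⟩)
        rw [pow_succ, mul_assoc]
        exact hy.2
      · right
        exact Finset.mem_symmDiff.2 (Or.inr ⟨hy.1, hyb⟩)
    have h2 := (Finset.card_le_card h1).trans (Finset.card_union_le _ _)
    have h3 := Finset.card_image_le (s := F.filter fun a => b ^ (s + 1) * a ∈ Λ)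
      (f := fun x => b * x)
    rw [add_mul, one_mul]
    omega

lemma dens_finset {Γ : Type*} (F : Finset Γ) (P : Γ → Prop) [DecidablePred P] :
    dens {a : F | P a} = ((F.filter P).card : ℝ) / F.card := by
  classical
  rw [dens, Fintype.expect_eq_sum_div_card, Fintype.card_coe]
  congr 1
  rw [Finset.card_filter, Nat.cast_sum, ← Finset.sum_coe_sort F]
  refine Finset.sum_congr rfl fun a _ => ?_
  by_cases h : P a <;> simp [h]

/-- The sums of the words on a combinatorial line form an arithmetic progression. -/
lemma exists_sum_line {k n : ℕ} (l : Line (Fin k) (Fin n)) :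
    ∃ c r : ℕ, 0 < r ∧ ∀ j, ∑ i, (l j i : ℕ) = j * r + c := by
  refine ⟨∑ i, (l.idxFun i).elim 0 Fin.val, (Finset.univ.filter fun i => l.idxFun i = none).card,
    ?_, fun j => ?_⟩
  · obtain ⟨i, hi⟩ := l.proper
    exact Finset.card_pos.2 ⟨i, by simp [hi]⟩
  · rw [Finset.card_filter, Finset.mul_sum, ← Finset.sum_add_distrib]
    refine Finset.sum_congr rfl fun i _ => ?_
    rw [Line.apply_def]
    cases h : l.idxFun i <;> simp [h]

end DensityHalesJewett

open DensityHalesJewett in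
/-- Generalized Szemerédi theorem: if `b ∈ Γ` fixes `Σ = {F_n}` from the right
(`|b F_n ∆ F_n|/|F_n| → 0`) and `Λ ⊆ Γ` has positive upper density with respect to `Σ`,
then for every positive integer `k` there exist `n > 0` and `a ∈ Γ` with
`b^(j n) * a ∈ Λ` for all `j = 0, 1, …, k-1`. -/
theorem stmt9 {Γ : Type*} [Group Γ] [Countable Γ] [DecidableEq Γ]
    (F : ℕ → Finset Γ) (hF : ∀ n, (F n).Nonempty) (b : Γ)
    (hb : Tendsto
      (fun n => ((symmDiff ((F n).image (fun x => b * x)) (F n)).card : ℝ) / ((F n).card : ℝ))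
      atTop (𝓝 0))
    (Λ : Set Γ) [DecidablePred (· ∈ Λ)]
    (hΛ : 0 < Filter.limsup (fun n => (((F n).filter (· ∈ Λ)).card : ℝ) / ((F n).card : ℝ)) atTop)
    (k : ℕ) (hk : 0 < k) :
    ∃ n : ℕ, 0 < n ∧ ∃ a : Γ, ∀ j < k, b ^ (j * n) * a ∈ Λ := by
  obtain ⟨δ, hδ0, hδ⟩ := exists_between hΛ
  obtain ⟨N, hN⟩ := lineProperty_fin k (δ / 2) (by positivity)
  have hk0 : Nonempty (Fin k) := ⟨⟨0, hk⟩⟩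
  have hfreq := frequently_lt_of_lt_limsup
    (IsCoboundedUnder.of_frequently_ge (a := 0) (Frequently.of_forall fun n => by positivity)) hδ
  have hev := hb.eventually_lt_const (show 0 < δ / 2 / (N * k + 1) by positivity)
  obtain ⟨n, hn, hn'⟩ := (hfreq.and_eventually hev).exists
  have hcard : (0 : ℝ) < (F n).card := by exact_mod_cast (hF n).card_pos
  have : Nonempty (F n) := (hF n).to_subtype
  have hw : ∀ w : Fin N → Fin k, δ / 2 ≤ dens {a : F n | b ^ (∑ i, (w i : ℕ)) * a ∈ Λ} := by
    intro w
    have hs : (∑ i, (w i : ℕ)) ≤ N * k := by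
      simpa using Finset.sum_le_card_nsmul Finset.univ (fun i => (w i : ℕ)) k
        fun i _ => (w i).isLt.le
    rw [dens_finset (F n) fun a => b ^ (∑ i, (w i : ℕ)) * a ∈ Λ, le_div_iff₀ hcard]
    have h1 := (card_filter_pow_mul_ge (F n) b Λ (∑ i, (w i : ℕ))).trans
      (Nat.add_le_add_left (Nat.mul_le_mul_right _ hs) _)
    rify at h1
    rw [lt_div_iff₀ hcard] at hn
    rw [div_lt_div_iff₀ hcard (by positivity)] at hn'
    nlinarith [Nat.cast_nonneg (α := ℝ)
      (symmDiff ((F n).image fun x => b * x) (F n)).card]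
  obtain ⟨a, ha⟩ := exists_le_dens_of_forall_le (X := F n)
    (fun a (w : Fin N → Fin k) => b ^ (∑ i, (w i : ℕ)) * a ∈ Λ) hw
  obtain ⟨l, hl⟩ := hN N le_rfl _ ha
  obtain ⟨c, r, hr, hsum⟩ := exists_sum_line l
  refine ⟨r, hr, b ^ c * a, fun j hj => ?_⟩
  have h1 : b ^ (∑ i, (l ⟨j, hj⟩ i : ℕ)) * a ∈ Λ := hl ⟨j, hj⟩
  rwa [hsum, pow_add, mul_assoc] at h1
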